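/- Fix an integer d ≥ 2 and an angle α ∈ (0, π/2]. There exists a finite subset T of the unit sphere S^{d-1} ⊂ ℝ^d of cardinality at least cos(α)/sin^{d-1}(α) such that for any two distinct points θ, θ' ∈ T, min{‖θ - θ'‖, ‖θ + θ'‖} > 2·sin(α/2). -/

import Mathlib

open MeasureTheory Set

/-- The part of the closed unit ball within angle `arccos c` of the line spanned by `θ`. -/
def doubleSector {E : Type*} [NormedAddCommGroup E] [InnerProductSpace ℝ E] (c : ℝ) (θ : E) :
    Set E :=
  {x | ‖x‖ ≤ 1 ∧ c * ‖x‖ ≤ |inner ℝ x θ|}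

/-- Moving the two halves of the fibre of a double sector towards the origin by `c * √q` places
them inside the fibre of the unit ball. -/
lemma volume_sector_fiber_le {c s : ℝ} (hc : 0 ≤ c) (hs : 0 < s)
    (hcs : s ^ 2 + c ^ 2 = 1) {q : ℝ} (hq : 0 ≤ q) :
    volume {t : ℝ | t ^ 2 + s ^ 2 * q ≤ 1 ∧ c ^ 2 * (t ^ 2 + s ^ 2 * q) ≤ t ^ 2} ≤
      volume {t : ℝ | t ^ 2 + q ≤ 1} := by
  have key : ∀ t : ℝ, t ^ 2 + s ^ 2 * q ≤ 1 ∧ c ^ 2 * (t ^ 2 + s ^ 2 * q) ≤ t ^ 2 →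
      q ≤ 1 ∧ c * √q ≤ |t| ∧ |t| ≤ c * √q + √(1 - q) := by
    rintro t ⟨h1, h2⟩
    have hs2 : 0 < s ^ 2 := by positivity
    have hsq := Real.sq_sqrt hq
    have h3 : c ^ 2 * q ≤ t ^ 2 := by
      have : s ^ 2 * (c ^ 2 * q) ≤ s ^ 2 * t ^ 2 := by nlinarith
      exact le_of_mul_le_mul_left this hs2
    have hq1 : q ≤ 1 := by nlinarith
    have hsq' := Real.sq_sqrt (sub_nonneg.2 hq1)
    refine ⟨hq1, (sq_le_sq₀ (by positivity) (abs_nonneg t)).1 ?_, ?_⟩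
    · rw [mul_pow, hsq, sq_abs]; exact h3
    · refine (sq_le_sq₀ (abs_nonneg t) (by positivity)).1 ?_
      have : 0 ≤ c * √q * √(1 - q) := by positivity
      rw [sq_abs]
      nlinarith
  by_cases hq1 : q ≤ 1
  swap
  · have : {t : ℝ | t ^ 2 + s ^ 2 * q ≤ 1 ∧ c ^ 2 * (t ^ 2 + s ^ 2 * q) ≤ t ^ 2} = ∅ :=
      eq_empty_of_forall_notMem fun t ht => hq1 (key t ht).1
    simp [this]
  calc _ ≤ volume (Icc (c * √q) (c * √q + √(1 - q)) ∪
        Icc (-(c * √q + √(1 - q))) (-(c * √q))) := by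
        refine measure_mono fun t ht => ?_
        obtain ⟨-, h1, h2⟩ := key t ht
        rcases abs_cases t with ⟨h, -⟩ | ⟨h, -⟩
        · left; constructor <;> linarith
        · right; constructor <;> linarith
    _ ≤ _ := measure_union_le _ _
    _ = volume (Icc (-√(1 - q)) (√(1 - q))) := by
        simp only [Real.volume_Icc]
        rw [← ENNReal.ofReal_add] <;> ring_nf <;> positivity
    _ ≤ _ := by
        refine measure_mono fun t ht => ?_
        have := abs_le.2 ht
        have h := Real.sq_sqrt (sub_nonneg.2 hq1)
        have : |t| ^ 2 ≤ √(1 - q) ^ 2 := by gcongr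
        rw [sq_abs] at this
        rw [mem_ofPred_eq]
        linarith

/-- The comparison of a double sector with the unit ball, in the product `ℝ × ℝⁿ`. -/
lemma volume_sector_prod_le {n : ℕ} {c s : ℝ} (hc : 0 ≤ c) (hs : 0 < s)
    (hcs : s ^ 2 + c ^ 2 = 1) :
    volume {p : ℝ × (Fin n → ℝ) | p.1 ^ 2 + ∑ i, p.2 i ^ 2 ≤ 1 ∧
        c ^ 2 * (p.1 ^ 2 + ∑ i, p.2 i ^ 2) ≤ p.1 ^ 2} ≤
      ENNReal.ofReal (s ^ n) * volume {p : ℝ × (Fin n → ℝ) | p.1 ^ 2 + ∑ i, p.2 i ^ 2 ≤ 1} := by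
  have hA : MeasurableSet {p : ℝ × (Fin n → ℝ) | p.1 ^ 2 + ∑ i, p.2 i ^ 2 ≤ 1 ∧
      c ^ 2 * (p.1 ^ 2 + ∑ i, p.2 i ^ 2) ≤ p.1 ^ 2} := by
    rw [ofPred_and]
    exact (measurableSet_le (by fun_prop) (by fun_prop)).inter
      (measurableSet_le (by fun_prop) (by fun_prop))
  have hB : MeasurableSet {p : ℝ × (Fin n → ℝ) | p.1 ^ 2 + ∑ i, p.2 i ^ 2 ≤ 1} :=
    measurableSet_le (by fun_prop) (by fun_prop)
  have hmap := Measure.map_addHaar_smul (volume : Measure (Fin n → ℝ)) hs.ne'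
  have hvol : (volume : Measure (Fin n → ℝ)) =
      ENNReal.ofReal (s ^ n) • Measure.map (s • ·) volume := by
    rw [hmap, smul_smul, Module.finrank_fin_fun, ← ENNReal.ofReal_mul (by positivity),
      abs_of_pos (by positivity), mul_inv_cancel₀ (by positivity), ENNReal.ofReal_one, one_smul]
  rw [Measure.volume_eq_prod, Measure.prod_apply_symm hA, Measure.prod_apply_symm hB]
  nth_rw 1 [hvol]
  rw [lintegral_smul_measure, lintegral_map (measurable_measure_prodMk_right hA) (by fun_prop),
    smul_eq_mul]
  refine mul_le_mul_right (lintegral_mono fun y => ?_) _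
  have := volume_sector_fiber_le hc hs hcs (q := ∑ i, y i ^ 2) (by positivity)
  simpa [Finset.mul_sum, mul_pow] using this

/-- The volume of the double sector of half-angle `arcsin s` is at most `s ^ n` times that of the
unit ball in dimension `n + 1`. -/
lemma volume_doubleSector_le {n : ℕ} {c s : ℝ} (hc : 0 ≤ c) (hs : 0 < s)
    (hcs : s ^ 2 + c ^ 2 = 1) {θ : EuclideanSpace ℝ (Fin (n + 1))} (hθ : ‖θ‖ = 1) :
    volume (doubleSector c θ) ≤
      ENNReal.ofReal (s ^ n) *
        volume (Metric.closedBall (0 : EuclideanSpace ℝ (Fin (n + 1))) 1) := by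
  obtain ⟨b, hb⟩ := Orthonormal.exists_orthonormalBasis_extension_of_card_eq (𝕜 := ℝ)
    (E := EuclideanSpace ℝ (Fin (n + 1))) (ι := Fin (n + 1)) (by simp) (v := fun _ => θ) (s := {0})
    (by
      constructor
      · simpa using hθ
      · intro i j hij
        exact (hij (Subsingleton.elim i j)).elim)
  have hb0 : b 0 = θ := hb 0 rfl
  have hmp := ((volume_preserving_piFinSuccAbove (fun _ : Fin (n + 1) => ℝ) 0).comp
    (PiLp.volume_preserving_ofLp (Fin (n + 1)))).comp b.measurePreserving_repr
  have hnorm (x : EuclideanSpace ℝ (Fin (n + 1))) :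
      ‖x‖ ^ 2 = b.repr x 0 ^ 2 + ∑ i : Fin n, b.repr x i.succ ^ 2 := by
    rw [← b.repr.norm_map, EuclideanSpace.real_norm_sq_eq, Fin.sum_univ_succ]
  have hinner (x : EuclideanSpace ℝ (Fin (n + 1))) : inner ℝ x θ = b.repr x 0 := by
    rw [b.repr_apply_apply, hb0, real_inner_comm]
  have hle (x : EuclideanSpace ℝ (Fin (n + 1))) : ‖x‖ ≤ 1 ↔ ‖x‖ ^ 2 ≤ 1 := by
    rw [sq_le_one_iff₀ (norm_nonneg x)]
  have h := volume_sector_prod_le (n := n) hc hs hcs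
  rw [← hmp.measure_preimage, ← hmp.measure_preimage] at h
  · convert h using 2
    · ext x
      have : c * ‖x‖ ≤ |inner ℝ x θ| ↔ c ^ 2 * ‖x‖ ^ 2 ≤ b.repr x 0 ^ 2 := by
        rw [← hinner, ← sq_abs (inner ℝ x θ), ← mul_pow, sq_le_sq₀ (by positivity) (by positivity)]
      simp only [doubleSector, mem_ofPred_eq, hle, this, hnorm]
      rfl
    · congr 1
      ext x
      simp only [mem_closedBall_zero_iff, hle, hnorm]
      rfl
  · exact (measurableSet_le (by fun_prop) (by fun_prop)).nullMeasurableSet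
  · rw [ofPred_and]
    exact ((measurableSet_le (by fun_prop) (by fun_prop)).inter
      (measurableSet_le (by fun_prop) (by fun_prop))).nullMeasurableSet

/-- Unit vectors at angle more than `α` are at distance more than the chord `2 * sin (α / 2)`. -/
lemma two_mul_sin_half_lt_norm_sub {E : Type*} [NormedAddCommGroup E] [InnerProductSpace ℝ E]
    {x y : E} (hx : ‖x‖ = 1) (hy : ‖y‖ = 1) {α : ℝ} (h : inner ℝ x y < Real.cos α) :
    2 * Real.sin (α / 2) < ‖x - y‖ := by
  apply lt_of_pow_lt_pow_left₀ 2 (norm_nonneg _)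
  have h1 := norm_sub_sq_real x y
  have h2 : Real.cos α = 1 - 2 * Real.sin (α / 2) ^ 2 := by
    rw [← Real.cos_two_mul_eq_one_sub, mul_div_cancel₀ _ two_ne_zero]
  rw [hx, hy] at h1
  nlinarith

/-- A set of `m` lines with `m * s ^ n < 1` leaves room for one more line at angle more than
`arcsin s` from all of them. -/
lemma exists_unit_abs_inner_lt {n : ℕ} {c s : ℝ} (hc : 0 ≤ c) (hs : 0 < s)
    (hcs : s ^ 2 + c ^ 2 = 1) {T : Finset (EuclideanSpace ℝ (Fin (n + 1)))}
    (hT : ∀ θ ∈ T, ‖θ‖ = 1) (hcard : T.card * s ^ n < 1) :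
    ∃ u : EuclideanSpace ℝ (Fin (n + 1)), ‖u‖ = 1 ∧ ∀ θ ∈ T, |inner ℝ u θ| < c := by
  set B := Metric.closedBall (0 : EuclideanSpace ℝ (Fin (n + 1))) 1
  have hlt : volume ({0} ∪ ⋃ θ ∈ T, doubleSector c θ) < volume B := by
    calc volume ({0} ∪ ⋃ θ ∈ T, doubleSector c θ)
        ≤ volume {(0 : EuclideanSpace ℝ (Fin (n + 1)))} + ∑ θ ∈ T, volume (doubleSector c θ) :=
          (measure_union_le _ _).trans
            (add_le_add_right (measure_biUnion_finset_le _ _) _)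
      _ ≤ ∑ _θ ∈ T, ENNReal.ofReal (s ^ n) * volume B := by
          rw [measure_singleton, zero_add]
          exact Finset.sum_le_sum fun θ hθ => volume_doubleSector_le hc hs hcs (hT θ hθ)
      _ = ENNReal.ofReal (T.card * s ^ n) * volume B := by
          rw [Finset.sum_const, nsmul_eq_mul, ENNReal.ofReal_mul (by positivity),
            ENNReal.ofReal_natCast, mul_assoc]
      _ < 1 * volume B := by
          refine ENNReal.mul_lt_mul_left ?_ ?_ (ENNReal.ofReal_lt_one.2 hcard)
          · exact (Metric.measure_closedBall_pos _ _ one_pos).ne'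
          · exact measure_closedBall_lt_top.ne
      _ = volume B := one_mul _
  obtain ⟨x, hxB, hx⟩ := not_subset.1 fun h => hlt.not_ge (measure_mono h)
  simp only [mem_union, mem_singleton_iff, mem_iUnion, not_or, not_exists] at hx
  obtain ⟨hx0, hx⟩ := hx
  have hpos : 0 < ‖x‖ := norm_pos_iff.2 hx0
  refine ⟨‖x‖⁻¹ • x, by simp [norm_smul, hpos.ne'], fun θ hθ => ?_⟩
  have h : |inner ℝ x θ| < c * ‖x‖ :=
    not_le.1 fun h => hx θ hθ ⟨mem_closedBall_zero_iff.1 hxB, h⟩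
  rw [real_inner_smul_left, abs_mul, abs_inv, abs_norm, inv_mul_lt_iff₀ hpos, mul_comm]
  exact h


/-- For `d ≥ 2` and an angle `α ∈ (0, π/2]`, there exists a finite set `T` of unit
vectors in `ℝ^d` of cardinality at least `cos(α)/sin^{d-1}(α)` such that any two distinct
points of `T` are at sign-insensitive distance more than `2·sin(α/2)`. -/
theorem stmt16 (d : ℕ) (hd : 2 ≤ d) (α : ℝ) (hα0 : 0 < α) (hα1 : α ≤ Real.pi / 2) :
    ∃ T : Finset (EuclideanSpace ℝ (Fin d)),
      (∀ θ ∈ T, ‖θ‖ = 1) ∧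
      Real.cos α / Real.sin α ^ (d - 1) ≤ (T.card : ℝ) ∧
      ∀ θ ∈ T, ∀ θ' ∈ T, θ ≠ θ' →
        2 * Real.sin (α / 2) < min ‖θ - θ'‖ ‖θ + θ'‖ := by
  obtain ⟨n, rfl⟩ : ∃ n, d = n + 1 := ⟨d - 1, by omega⟩
  rw [Nat.add_sub_cancel]
  have hs : 0 < Real.sin α := Real.sin_pos_of_pos_of_lt_pi hα0 (by linarith [Real.pi_pos])
  have hc : 0 ≤ Real.cos α := Real.cos_nonneg_of_mem_Icc ⟨by linarith, hα1⟩
  have hsn : 0 < Real.sin α ^ n := by positivity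
  have grow : ∀ k : ℕ, ∃ T : Finset (EuclideanSpace ℝ (Fin (n + 1))),
      (∀ θ ∈ T, ‖θ‖ = 1) ∧ (k ≤ T.card ∨ 1 ≤ T.card * Real.sin α ^ n) ∧
      ∀ θ ∈ T, ∀ θ' ∈ T, θ ≠ θ' → |inner ℝ θ θ'| < Real.cos α := by
    intro k
    induction k with
    | zero => exact ⟨∅, by simp⟩
    | succ k ih =>
      obtain ⟨T, hT, hk, hsep⟩ := ih
      rcases le_or_gt 1 (T.card * Real.sin α ^ n) with h | h
      · exact ⟨T, hT, Or.inr h, hsep⟩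
      obtain ⟨u, hu, huT⟩ := exists_unit_abs_inner_lt hc hs (Real.sin_sq_add_cos_sq α) hT h
      classical
      have hnot : u ∉ T := fun hmem => by
        have := huT u hmem
        rw [real_inner_self_eq_norm_sq, hu] at this
        norm_num at this
        exact this.not_ge (Real.cos_le_one α)
      refine ⟨insert u T, ?_, Or.inl ?_, ?_⟩
      · simpa [hu] using hT
      · rw [Finset.card_insert_of_notMem hnot]
        have := hk.resolve_right h.not_ge
        omega
      · intro θ hθ θ' hθ' hne
        rcases Finset.mem_insert.1 hθ with rfl | hθ₁ <;>
          rcases Finset.mem_insert.1 hθ' with rfl | hθ₂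
        · exact (hne rfl).elim
        · exact huT θ' hθ₂
        · rw [real_inner_comm]
          exact huT θ hθ₁
        · exact hsep θ hθ₁ θ' hθ₂ hne
  obtain ⟨T, hT, hcard, hsep⟩ := grow ⌈1 / Real.sin α ^ n⌉₊
  refine ⟨T, hT, ?_, fun θ hθ θ' hθ' hne => ?_⟩
  · calc Real.cos α / Real.sin α ^ n ≤ 1 / Real.sin α ^ n := by
          gcongr
          exact Real.cos_le_one α
      _ ≤ T.card := by
          rcases hcard with h | h
          · exact Nat.ceil_le.1 h
          · exact (div_le_iff₀ hsn).2 h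
  · obtain ⟨h1, h2⟩ := abs_lt.1 (hsep θ hθ θ' hθ' hne)
    refine lt_min (two_mul_sin_half_lt_norm_sub (hT θ hθ) (hT θ' hθ') h2) ?_
    rw [← sub_neg_eq_add]
    refine two_mul_sin_half_lt_norm_sub (hT θ hθ) (by rw [norm_neg, hT θ' hθ']) ?_
    rw [inner_neg_right]
    linarith
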